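/- Let $m,n\ge 0$ be integers, write $[n]=\{1,\dots,n\}$, and let $$\mathcal A_m^n=\bigl\{\{x\in\mathbb R^n: x_i-x_j=s\}\;:\;1\le i<j\le n,\ s\in\mathbb Z,\ -m\le s\le m\bigr\}$$ be the $m$-Catalan arrangement. Let $\mathrm{Tr}_m^n$ be the set of triples $(i,j,s)$ with $i,j\in[n]$, $i\ne j$, $s\in\{0,\dots,m\}$ and ($s>0$ or $i>j$); every hyperplane of $\mathcal A_m^n$ is $\{x_i-x_j=s\}$ for exactly one $(i,j,s)\in\mathrm{Tr}_m^n$. For $\mathcal A\subseteq\mathcal A_m^n$ let $\mathrm{Tr}_m^n(\mathcal A)$ be the set of $(i,j,s)\in\mathrm{Tr}_m^n$ with $\{x_i-x_j=s\}\in\mathcal A$. Call $\mathcal A$ transitive if for all distinct $i,j,k\in[n]$ and all integers $s,t\ge0$ with $(i,j,s),(j,k,t)\in\mathrm{Tr}_m^n$: if $\{x_i-x_j=s\}\notin\mathcal A$ and $\{x_j-x_k=t\}\notin\mathcal A$, then $\{x_i-x_k=s+t\}\notin\mathcal A$. An $(m,n)$-tree is a rooted tree with $n$ internal nodes, labeled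 bijectively by $[n]$ (and identified with their labels), in which every node $j$ has exactly $m+1$ ordered children $0\text{-child}(j),\dots,m\text{-child}(j)$, each of them a node or an unlabeled leaf. A node $i$ is the $s$-cadet of a node $j$ if $i=s\text{-child}(j)$ and $t\text{-child}(j)$ is a leaf for all $t$ with $s<t\le m$. Let $\mathcal T_m^n(\mathcal A)$ be the set of $(m,n)$-trees in which, for every $(i,j,s)\in\mathrm{Tr}_m^n\setminus\mathrm{Tr}_m^n(\mathcal A)$, the node $i$ is not the $s$-cadet of $j$. For a vertex $v$ (node or leaf) of an $(m,n)$-tree $T$ with root-to-$v$ path $v_0,\dots,v_k=v$, where $v_p=s_p\text{-child}(v_{p-1})$, let $\mathrm{path}_T(v)=(s_1,\dots,s_k)$ and $\mathrm{drift}_T(v)=s_1+\dots+s_k$. Define a total order $\preceq_T$ on the vertices of $T$, with strict part $\prec_T$, as follows: for distinct vertices $v,w$ with $\mathrm{path}_T(v)=(s_1,\dots,s_k)$ and $\mathrm{path}_T(w)=(t_1,\dots,t_\ell)$, $v\prec_T w$ if and only if either $\mathrm{drift}_T(v)<\mathrm{drift}_T(w)$, or $\mathrm{drift}_T(v)=\mathrm{drift}_T(w)$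 and there is $p\le\min(k,\ell)$ such that $(s_1,\dots,s_p)=(t_1,\dots,t_p)$ and either $p=k$, or $p<\min(k,\ell)$ and $s_{p+1}>t_{p+1}$. For $T\in\mathcal T_m^n(\mathcal A)$ let $$\Phi_{\mathcal A}(T)=\bigcap_{\substack{(i,j,s)\in\mathrm{Tr}_m^n(\mathcal A)\\ i\prec_T s\text{-child}(j)}}\{x\in\mathbb R^n: x_i-x_j<s\}\;\cap\;\bigcap_{\substack{(i,j,s)\in\mathrm{Tr}_m^n(\mathcal A)\\ i\succeq_T s\text{-child}(j)}}\{x\in\mathbb R^n: x_i-x_j>s\}.$$ Finally, let $\mathcal R(\mathcal A)$ be the set of regions of $\mathcal A$, that is, of connected components of $\mathbb R^n\setminus\bigcup_{H\in\mathcal A}H$. If $\mathcal A\subseteq\mathcal A_m^n$ is transitive, then $\Phi_{\mathcal A}$ is a bijection from $\mathcal T_m^n(\mathcal A)$ onto $\mathcal R(\mathcal A)$; in particular, for every $T\in\mathcal T_m^n(\mathcal A)$ the polyhedron $\Phi_{\mathcal A}(T)$ is nonempty and is a region of $\mathcal A$. -/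

import Mathlib

namespace Braid

/-- The set `{x ∈ ℝ^n | x i - x j = s}` (a hyperplane when `i ≠ j`). -/
def hyp (n : ℕ) (i j : Fin n) (s : ℝ) : Set (Fin n → ℝ) := {x | x i - x j = s}

/-- The `m`-Catalan arrangement `A_m^n`, as a set of hyperplanes. -/
def catArr (m n : ℕ) : Set (Set (Fin n → ℝ)) :=
  {H | ∃ i j : Fin n, ∃ s : ℤ, i < j ∧ -(m : ℤ) ≤ s ∧ s ≤ (m : ℤ) ∧ H = hyp n i j (s : ℝ)}

/-- `(i,j,s) ∈ Tr_m^n`. -/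
def TrIdx (m n : ℕ) (i j : Fin n) (s : ℕ) : Prop := s ≤ m ∧ i ≠ j ∧ (0 < s ∨ j < i)

/-- `(i,j,s) ∈ Tr_m^n(A)`. -/
def TrIdxA (m n : ℕ) (A : Set (Set (Fin n → ℝ))) (i j : Fin n) (s : ℕ) : Prop :=
  TrIdx m n i j s ∧ hyp n i j (s : ℝ) ∈ A

/-- `A` is transitive (as a sub-arrangement of `A_m^n`). -/
def IsTransitive (m n : ℕ) (A : Set (Set (Fin n → ℝ))) : Prop :=
  ∀ i j k : Fin n, i ≠ j → j ≠ k → i ≠ k → ∀ s t : ℕ,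
    TrIdx m n i j s → TrIdx m n j k t →
    hyp n i j (s : ℝ) ∉ A → hyp n j k (t : ℝ) ∉ A → hyp n i k ((s : ℝ) + (t : ℝ)) ∉ A

/-- An `(m,n)`-tree: a rooted `(m+1)`-ary tree whose `n` internal nodes are labeled bijectively
by `Fin n` (leaves unlabeled). A vertex is identified with its root-to-vertex word of child
indices in `{0,…,m}`, so that the tree is the prefix-closed set of words of its nodes,
together with the label of each node. The vertex `s`-child`(j)` is the word `path j ++ [s]`;
it is a leaf when no node has this word. -/
structure Tree (m n : ℕ) where
  path : Fin n → List ℕ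
  entry_le : ∀ v : Fin n, ∀ s ∈ path v, s ≤ m
  inj : Function.Injective path
  parent_closed : ∀ v : Fin n, path v ≠ [] → ∃ w : Fin n, path w = (path v).dropLast

namespace Tree

variable {m n : ℕ}

/-- The vertex `s`-child`(j)` (a node or a leaf), as a word. -/
def child (T : Tree m n) (j : Fin n) (s : ℕ) : List ℕ := T.path j ++ [s]

/-- The node `i` is the vertex `s`-child`(j)`. -/
def IsChild (T : Tree m n) (i j : Fin n) (s : ℕ) : Prop := T.path i = T.child j s

/-- The vertex `s`-child`(j)` is a leaf. -/
def ChildIsLeaf (T : Tree m n) (j : Fin n) (s : ℕ) : Prop := ∀ i : Fin n, ¬ T.IsChild i j s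

/-- `i = s`-cadet`(j)`. -/
def IsCadet (T : Tree m n) (i j : Fin n) (s : ℕ) : Prop :=
  T.IsChild i j s ∧ ∀ t : ℕ, s < t → t ≤ m → T.ChildIsLeaf j t

end Tree

/-- The strict order `v ≺_T w` on the vertices of a tree, in terms of their words `p` and `q`:
the vertices are distinct and either `drift(v) < drift(w)`, or the drifts are equal and there
is `c ≤ p.length` such that the first `c` entries of `p` and `q` agree and either
`c = p.length` or the next entry of `p` is larger than the next entry of `q`.
The drift of a vertex is the sum of its word. -/
def vlt (p q : List ℕ) : Prop :=
  p ≠ q ∧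
    (p.sum < q.sum ∨
      (p.sum = q.sum ∧ ∃ c ≤ p.length, p.take c = q.take c ∧
        (c = p.length ∨ ∃ (h1 : c < p.length) (h2 : c < q.length), q[c] < p[c])))

/-- The weak order `v ≼_T w`. -/
def vle (p q : List ℕ) : Prop := vlt p q ∨ p = q

/-- The set `T_m^n(A)` of trees. -/
def Tset (m n : ℕ) (A : Set (Set (Fin n → ℝ))) : Set (Tree m n) :=
  {T | ∀ i j s, TrIdx m n i j s → ¬ TrIdxA m n A i j s → ¬ T.IsCadet i j s}

/-- The polyhedron `Φ_A(T)`. -/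
def Phi (m n : ℕ) (A : Set (Set (Fin n → ℝ))) (T : Tree m n) : Set (Fin n → ℝ) :=
  {x | ∀ (i j : Fin n) (s : ℕ), TrIdxA m n A i j s →
        (vlt (T.path i) (T.child j s) → x i - x j < (s : ℝ)) ∧
        (vle (T.child j s) (T.path i) → (s : ℝ) < x i - x j)}

/-- The set of regions of `A`: the connected components of the complement of the union of `A`. -/
def regions (n : ℕ) (A : Set (Set (Fin n → ℝ))) : Set (Set (Fin n → ℝ)) :=
  {R | ∃ x ∈ (⋃₀ A)ᶜ, R = connectedComponentIn (⋃₀ A)ᶜ x}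

end Braid

namespace Braid

/-! ### The lexicographic order on words -/

/-- Lexicographic order on words in which prefixes come first and larger entries come first. -/
def lexlt : List ℕ → List ℕ → Prop
  | [], [] => False
  | [], _ :: _ => True
  | _ :: _, [] => False
  | a :: p, b :: q => b < a ∨ (a = b ∧ lexlt p q)

theorem lexlt_irrefl (p : List ℕ) : ¬ lexlt p p := by
  induction p with
  | nil => simp [lexlt]
  | cons a p ih => simp [lexlt, ih]

theorem lexlt_trichotomy (p q : List ℕ) : lexlt p q ∨ p = q ∨ lexlt q p := by
  induction p generalizing q with
  | nil => cases q <;> simp [lexlt]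
  | cons a p ih =>
    cases q with
    | nil => simp [lexlt]
    | cons b q =>
      rcases lt_trichotomy a b with h | h | h
      · simp [lexlt, h]
      · subst h
        simpa [lexlt] using ih q
      · simp [lexlt, h]

theorem lexlt_asymm {p q : List ℕ} (h : lexlt p q) : ¬ lexlt q p := by
  induction p generalizing q with
  | nil => cases q <;> simp_all [lexlt]
  | cons a p ih =>
    cases q with
    | nil => simp [lexlt] at h
    | cons b q =>
      simp only [lexlt] at h ⊢
      rintro (h' | ⟨h', h''⟩)
      · rcases h with h | ⟨h, -⟩ <;> omega
      · rcases h with h | ⟨-, h⟩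
        · omega
        · exact ih h h''

theorem not_lexlt_append_self (p : List ℕ) (a : ℕ) : ¬ lexlt (p ++ [a]) p := by
  induction p with
  | nil => simp [lexlt]
  | cons b p ih => simpa [lexlt] using ih

theorem lexlt_of_append_lexlt {p q : List ℕ} {a : ℕ} (h : lexlt (p ++ [a]) q) : lexlt p q := by
  induction p generalizing q with
  | nil => cases q <;> simp_all [lexlt]
  | cons b p ih =>
    cases q with
    | nil => simp [lexlt] at h
    | cons c q =>
      simp only [List.cons_append, lexlt] at h ⊢
      exact h.imp_right fun h => ⟨h.1, ih h.2⟩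

theorem lexlt_append_of_lexlt {p q : List ℕ} {a : ℕ} (h : lexlt p q) : lexlt p (q ++ [a]) := by
  induction p generalizing q with
  | nil => cases q <;> simp_all [lexlt]
  | cons b p ih =>
    cases q with
    | nil => simp [lexlt] at h
    | cons c q =>
      simp only [List.cons_append, lexlt] at h ⊢
      exact h.imp_right fun h => ⟨h.1, ih h.2⟩

theorem append_lexlt_or_eq {p q : List ℕ} {a : ℕ} (h : lexlt p q) (hs : q.sum ≤ p.sum + a) :
    lexlt (p ++ [a]) q ∨ p ++ [a] = q := by
  induction p generalizing q with
  | nil =>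
    cases q with
    | nil => simp [lexlt] at h
    | cons b q =>
      simp only [List.sum_cons, List.sum_nil, zero_add] at hs
      simp only [List.nil_append, lexlt, List.cons.injEq]
      rcases Nat.lt_or_ge b a with hb | hb
      · exact Or.inl (Or.inl hb)
      · have : a = b := by omega
        cases q <;> simp [this, lexlt]
  | cons b p ih =>
    cases q with
    | nil => simp [lexlt] at h
    | cons c q =>
      simp only [List.cons_append, lexlt, List.cons.injEq, List.sum_cons] at h hs ⊢
      rcases h with h | ⟨rfl, h⟩
      · exact Or.inl (Or.inl h)
      · rcases ih h (by omega) with h' | h'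
        · exact Or.inl (Or.inr ⟨rfl, h'⟩)
        · exact Or.inr ⟨rfl, h'⟩

theorem append_lexlt_iff {p q : List ℕ} {a : ℕ} (hne : p ++ [a] ≠ q) (hs : q.sum ≤ p.sum + a) :
    lexlt (p ++ [a]) q ↔ lexlt p q :=
  ⟨lexlt_of_append_lexlt, fun h => (append_lexlt_or_eq h hs).resolve_right hne⟩

theorem exists_take_eq_iff (p q : List ℕ) :
    (∃ c ≤ p.length, p.take c = q.take c ∧
        (c = p.length ∨ ∃ (_ : c < p.length) (_ : c < q.length), q[c] < p[c])) ↔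
      (lexlt p q ∨ p = q) := by
  induction p generalizing q with
  | nil => cases q <;> simp [lexlt]
  | cons a p ih =>
    cases q with
    | nil =>
      simp only [lexlt, reduceCtorEq, or_self, iff_false]
      rintro ⟨c, -, h, h'⟩
      rcases h' with rfl | ⟨_, h', _⟩
      · simp at h
      · simp at h'
    | cons b q =>
      have key := ih q
      constructor
      · rintro ⟨c, hc, h, h'⟩
        cases c with
        | zero =>
          rcases h' with h' | ⟨_, _, h'⟩
          · simp at h'
          · exact Or.inl (Or.inl (by simpa using h'))
        | succ c =>
          simp only [List.take_succ_cons, List.cons.injEq] at h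
          have : lexlt p q ∨ p = q := by
            refine key.1 ⟨c, by simpa using hc, h.2, ?_⟩
            rcases h' with h' | ⟨h1, h2, h3⟩
            · exact Or.inl (by simpa using h')
            · exact Or.inr ⟨by simpa using h1, by simpa using h2, by simpa using h3⟩
          rcases this with h'' | h''
          · exact Or.inl (Or.inr ⟨h.1, h''⟩)
          · exact Or.inr (by rw [h.1, h''])
      · intro h
        by_cases hab : b < a
        · exact ⟨0, by simp, by simp, Or.inr ⟨by simp, by simp, by simpa using hab⟩⟩
        · have : a = b ∧ (lexlt p q ∨ p = q) := by
            rcases h with (h | h) | h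
            · exact absurd h hab
            · exact ⟨h.1, Or.inl h.2⟩
            · simp only [List.cons.injEq] at h
              exact ⟨h.1, Or.inr h.2⟩
          obtain ⟨rfl, hpq⟩ := this
          obtain ⟨c, hc, h1, h2⟩ := key.2 hpq
          refine ⟨c + 1, by simpa using hc, by simpa using h1, ?_⟩
          rcases h2 with h2 | ⟨h2, h3, h4⟩
          · exact Or.inl (by simpa using h2)
          · exact Or.inr ⟨by simpa using h2, by simpa using h3, by simpa using h4⟩

theorem vlt_iff (p q : List ℕ) :
    vlt p q ↔ p.sum < q.sum ∨ (p.sum = q.sum ∧ lexlt p q) := by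
  unfold vlt
  rw [exists_take_eq_iff]
  constructor
  · rintro ⟨hne, h | ⟨h, h' | h'⟩⟩
    · exact Or.inl h
    · exact Or.inr ⟨h, h'⟩
    · exact absurd h' hne
  · rintro (h | ⟨h, h'⟩)
    · exact ⟨by rintro rfl; omega, Or.inl h⟩
    · exact ⟨by rintro rfl; exact lexlt_irrefl _ h', Or.inr ⟨h, Or.inl h'⟩⟩

theorem vle_iff_not_vlt (p q : List ℕ) : vle p q ↔ ¬ vlt q p := by
  unfold vle
  rw [vlt_iff, vlt_iff]
  constructor
  · rintro ((h | ⟨h, h'⟩) | rfl)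
    · omega
    · rintro (h2 | ⟨-, h2⟩)
      · omega
      · exact lexlt_asymm h' h2
    · rintro (h2 | ⟨-, h2⟩)
      · omega
      · exact lexlt_irrefl _ h2
  · intro h
    push Not at h
    rcases h.1.lt_or_eq with h1 | h1
    · exact Or.inl (Or.inl h1)
    · rcases lexlt_trichotomy p q with h2 | h2 | h2
      · exact Or.inl (Or.inr ⟨h1, h2⟩)
      · exact Or.inr h2
      · exact absurd h2 (h.2 h1.symm)

/-- The comparison of a node with word `p` to the `u`-child of another node with word `q`. -/
def below (p q : List ℕ) (u : ℕ) : Prop :=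
  p.sum < q.sum + u ∨ (p.sum = q.sum + u ∧ lexlt p q)

theorem vlt_append_iff {p q : List ℕ} (hne : p ≠ q) (u : ℕ) :
    vlt p (q ++ [u]) ↔ below p q u := by
  rw [vlt_iff, below, List.sum_append, List.sum_singleton]
  refine or_congr_right (and_congr_right fun hs => ⟨fun h => ?_, lexlt_append_of_lexlt⟩)
  rcases lexlt_trichotomy p q with h' | h' | h'
  · exact h'
  · exact absurd h' hne
  · rcases append_lexlt_or_eq h' hs.le with h'' | h''
    · exact absurd h (lexlt_asymm h'')
    · exact absurd h (by rw [h'']; exact lexlt_irrefl _)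

theorem vle_append_iff {p q : List ℕ} (hne : p ≠ q) (u : ℕ) :
    vle (q ++ [u]) p ↔ ¬ below p q u := by
  rw [vle_iff_not_vlt, vlt_append_iff hne]

end Braid

namespace Braid

variable {m n : ℕ}

/-! ### Trees and generic points -/

/-- The point `x` lies on no hyperplane of the `m`-Catalan arrangement. -/
def Generic (m : ℕ) (x : Fin n → ℝ) : Prop :=
  ∀ i j : Fin n, i ≠ j → ∀ s : ℕ, s ≤ m → x i ≠ x j + s

theorem Generic.add_ne {x : Fin n → ℝ} (hx : Generic m x) {i j : Fin n} (hij : i ≠ j)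
    {s t : ℕ} (hs : s ≤ m) (ht : t ≤ m) : x i + s ≠ x j + t := by
  intro h
  rcases le_total s t with hst | hst
  · refine hx i j hij (t - s) (by omega) ?_
    push_cast [hst]
    linarith
  · refine hx j i hij.symm (s - t) (by omega) ?_
    push_cast [hst]
    linarith

/-- The order of the words `p j` of the nodes is the order of the coordinates of `x`. -/
def Agrees (m : ℕ) (p : Fin n → List ℕ) (x : Fin n → ℝ) (i j : Fin n) : Prop :=
  ∀ s : ℕ, s ≤ m → (x i < x j + s ↔ below (p i) (p j) s)

theorem Agrees.add_lt_iff {p : Fin n → List ℕ} {x : Fin n → ℝ} (hx : Generic m x)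
    {i j : Fin n} (hij : i ≠ j) (hp : p i ≠ p j) (h : Agrees m p x i j) (h' : Agrees m p x j i)
    {s t : ℕ} (hs : s ≤ m) (ht : t ≤ m) :
    x i + s < x j + t ↔
      (p i).sum + s < (p j).sum + t ∨ ((p i).sum + s = (p j).sum + t ∧ lexlt (p i) (p j)) := by
  rcases le_total s t with hst | hst
  · have h1 := h (t - s) (by omega)
    rw [below] at h1
    have h2 : x i + s < x j + t ↔ x i < x j + ((t - s : ℕ) : ℝ) := by
      push_cast [hst]
      constructor <;> intro h <;> linarith
    rw [h2, h1]
    refine or_congr (by omega) (and_congr_left fun _ => by omega)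
  · have h1 := h' (s - t) (by omega)
    have h2 : x i + s < x j + t ↔ ¬ x j < x i + ((s - t : ℕ) : ℝ) := by
      have := hx.add_ne hij hs ht
      push_cast [hst]
      constructor
      · intro h
        linarith
      · intro h
        refine lt_of_le_of_ne ?_ this
        linarith
    rw [h2, h1, below]
    rcases lexlt_trichotomy (p i) (p j) with h3 | h3 | h3
    · have := lexlt_asymm h3
      simp only [h3, this, and_true, and_false, or_false]
      omega
    · exact absurd h3 hp
    · have := lexlt_asymm h3
      simp only [h3, this, and_true, and_false, or_false]
      omega

/-- `x j + s` is the largest number `x k + u`, with `u ≤ m`, below `x i`. -/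
structure IsSlot (m : ℕ) (x : Fin n → ℝ) (i j : Fin n) (s : ℕ) : Prop where
  le : s ≤ m
  lt : x j + s < x i
  not_between : ∀ (k : Fin n) (u : ℕ), u ≤ m → x j + s < x k + u → x i ≤ x k + u

theorem IsSlot.lt_add_iff {x : Fin n → ℝ} (hx : Generic m x) {i j : Fin n} {s : ℕ}
    (h : IsSlot m x i j s) {k : Fin n} (hk : i ≠ k) {u : ℕ} (hu : u ≤ m) :
    x i < x k + u ↔ x j + s < x k + u :=
  ⟨h.lt.trans, fun h' => lt_of_le_of_ne (h.not_between k u hu h') (hx i k hk u hu)⟩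

theorem IsSlot.parent_unique {x : Fin n → ℝ} (hx : Generic m x) {i j k : Fin n} {s t : ℕ}
    (h : IsSlot m x i j s) (h' : IsSlot m x i k t) : j = k ∧ s = t := by
  have h1 : x j + s = x k + t := by
    rcases lt_trichotomy (x j + s) (x k + t) with h1 | h1 | h1
    · exact absurd (h.not_between k t h'.le h1) (not_le.2 h'.lt)
    · exact h1
    · exact absurd (h'.not_between j s h.le h1) (not_le.2 h.lt)
  have hjk : j = k := by
    by_contra hjk
    exact hx.add_ne hjk h.le h'.le h1
  subst hjk
  exact ⟨rfl, by simpa using h1⟩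

theorem IsSlot.child_unique {x : Fin n → ℝ} (hx : Generic m x) {i i' j : Fin n} {s : ℕ}
    (h : IsSlot m x i j s) (h' : IsSlot m x i' j s) : i = i' := by
  by_contra hne
  have h1 := h.not_between i' 0 (Nat.zero_le _) (by simpa using h'.lt)
  have h2 := h'.not_between i 0 (Nat.zero_le _) (by simpa using h.lt)
  have h3 := hx i i' hne 0 (Nat.zero_le _)
  simp only [Nat.cast_zero, add_zero] at h1 h2 h3
  exact h3 (le_antisymm h1 h2)

theorem IsSlot.exists_of_lt {x : Fin n → ℝ} {i j : Fin n} {s : ℕ} (hs : s ≤ m)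
    (h : x j + s < x i) : ∃ k u, IsSlot m x i k u := by
  classical
  let S : Finset (Fin n × Fin (m + 1)) :=
    Finset.univ.filter fun a => x a.1 + ((a.2 : ℕ) : ℝ) < x i
  have hS : S.Nonempty := ⟨(j, ⟨s, by omega⟩), by simpa [S] using h⟩
  obtain ⟨a, ha, hmax⟩ := S.exists_max_image (fun a => x a.1 + ((a.2 : ℕ) : ℝ)) hS
  refine ⟨a.1, a.2, by omega, by simpa [S] using ha, fun k u hu hlt => ?_⟩
  by_contra hcon
  have := hmax (k, ⟨u, by omega⟩) (by simpa [S] using hcon)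
  exact absurd hlt (not_lt.2 this)

/-- The word order of the tree `T` is the order of the coordinates of the generic point `x`. -/
structure Compatible (T : Tree m n) (x : Fin n → ℝ) : Prop where
  generic : Generic m x
  agrees : ∀ i j, i ≠ j → Agrees m T.path x i j

namespace Compatible

variable {T T' : Tree m n} {x : Fin n → ℝ}

theorem path_ne (T : Tree m n) {i j : Fin n} (h : i ≠ j) : T.path i ≠ T.path j :=
  fun h' => h (T.inj h')

theorem isSlot_of_isChild (h : Compatible T x) {i j : Fin n} {s : ℕ} (hc : T.IsChild i j s) :
    IsSlot m x i j s := by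
  have hs : s ≤ m := T.entry_le i s (by rw [hc, Tree.child]; simp)
  have hc' : T.path i = T.path j ++ [s] := hc
  have hsum : (T.path i).sum = (T.path j).sum + s := by rw [hc']; simp
  have hij : i ≠ j := by
    rintro rfl
    simpa using congrArg List.length hc'
  refine ⟨hs, ?_, fun k u hu hlt => ?_⟩
  · have h1 := h.agrees i j hij s hs
    rw [below, hsum, hc'] at h1
    have h2 : ¬ x i < x j + s := by
      rw [h1]
      rintro (h2 | ⟨-, h2⟩)
      · omega
      · exact not_lexlt_append_self _ _ h2
    exact lt_of_le_of_ne (not_lt.1 h2) (h.generic i j hij s hs).symm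
  · rcases eq_or_ne i k with rfl | hik
    · simp
    refine le_of_lt ((h.agrees i k hik u hu).2 ?_)
    rw [below, hsum]
    rcases eq_or_ne j k with rfl | hjk
    · left
      have : (s : ℝ) < u := by linarith
      have : s < u := by exact_mod_cast this
      omega
    · rw [(h.agrees j k hjk).add_lt_iff h.generic hjk (path_ne T hjk)
        (h.agrees k j hjk.symm) hs hu] at hlt
      refine hlt.imp_right fun hlt => ⟨hlt.1, ?_⟩
      rw [hc', append_lexlt_iff (by rw [← hc']; exact path_ne T hik) (by omega)]
      exact hlt.2

theorem exists_isChild_of_path_ne_nil (T : Tree m n) {i : Fin n} (h : T.path i ≠ []) :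
    ∃ j s, T.IsChild i j s := by
  obtain ⟨j, hj⟩ := T.parent_closed i h
  refine ⟨j, (T.path i).getLast h, ?_⟩
  rw [Tree.IsChild, Tree.child, hj]
  exact (List.dropLast_append_getLast h).symm

theorem exists_isChild_of_lt (h : Compatible T x) {i j : Fin n} {s : ℕ} (hs : s ≤ m)
    (hlt : x j + s < x i) : ∃ k u, T.IsChild i k u := by
  apply exists_isChild_of_path_ne_nil
  intro hnil
  have hij : i ≠ j := by
    rintro rfl
    have : (0 : ℝ) ≤ s := s.cast_nonneg
    linarith
  have h1 : ¬ below (T.path i) (T.path j) s := by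
    rw [← h.agrees i j hij s hs]
    linarith
  have h2 := path_ne T hij
  rw [hnil] at h1 h2
  apply h1
  cases hq : T.path j with
  | nil => exact absurd hq h2.symm
  | cons b q =>
    rcases Nat.eq_zero_or_pos ((b :: q).sum + s) with h3 | h3
    · exact Or.inr ⟨by simpa using h3.symm, trivial⟩
    · exact Or.inl (by simpa using h3)

theorem isChild_iff_isSlot (h : Compatible T x) {i j : Fin n} {s : ℕ} :
    T.IsChild i j s ↔ IsSlot m x i j s := by
  refine ⟨h.isSlot_of_isChild, fun hs => ?_⟩
  obtain ⟨k, u, hc⟩ := h.exists_isChild_of_lt hs.le hs.lt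
  obtain ⟨rfl, rfl⟩ := hs.parent_unique h.generic (h.isSlot_of_isChild hc)
  exact hc

theorem tree_unique (h : Compatible T x) (h' : Compatible T' x) : T = T' := by
  have key : ∀ l : ℕ, ∀ i, (T.path i).length = l → T.path i = T'.path i := by
    intro l
    induction l with
    | zero =>
      intro i hi
      rw [List.length_eq_zero_iff] at hi
      by_contra hne
      rw [hi] at hne
      obtain ⟨j, s, hc⟩ := exists_isChild_of_path_ne_nil T' (Ne.symm hne)
      rw [h'.isChild_iff_isSlot, ← h.isChild_iff_isSlot, Tree.IsChild, Tree.child, hi] at hc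
      simp at hc
    | succ l ih =>
      intro i hi
      obtain ⟨j, s, hc⟩ := exists_isChild_of_path_ne_nil T (i := i) (by
        intro h0
        rw [h0] at hi
        simp at hi)
      have hc' := hc
      rw [h.isChild_iff_isSlot, ← h'.isChild_iff_isSlot] at hc'
      rw [Tree.IsChild, Tree.child] at hc hc'
      rw [hc, hc', ih j]
      rw [hc] at hi
      simpa using hi
  cases T
  cases T'
  simp only [Tree.mk.injEq]
  exact funext fun i => key _ i rfl

end Compatible

/-! ### The tree of a generic point -/

open Classical in
/-- The number of coordinates of `x` below `x i`. -/
noncomputable def rank (x : Fin n → ℝ) (i : Fin n) : ℕ :=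
  (Finset.univ.filter fun k => x k < x i).card

theorem rank_lt {x : Fin n → ℝ} {i j : Fin n} (h : x i < x j) : rank x i < rank x j := by
  classical
  apply Finset.card_lt_card
  refine Finset.ssubset_iff_of_subset (fun k hk => ?_) |>.2 ⟨i, ?_, ?_⟩
  · simp only [Finset.mem_filter, Finset.mem_univ, true_and] at hk ⊢
    exact hk.trans h
  · simpa using h
  · simp

theorem IsSlot.rank_lt {x : Fin n → ℝ} {i j : Fin n} {s : ℕ} (h : IsSlot m x i j s) :
    rank x j < rank x i := by
  apply Braid.rank_lt
  have := h.lt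
  have : (0 : ℝ) ≤ s := s.cast_nonneg
  linarith

open Classical in
/-- The word of the node `i` in the tree of the generic point `x`. -/
noncomputable def slotPath (m : ℕ) (x : Fin n → ℝ) (i : Fin n) : List ℕ :=
  if h : ∃ k u, IsSlot m x i k u then slotPath m x h.choose ++ [h.choose_spec.choose] else []
termination_by rank x i
decreasing_by exact h.choose_spec.choose_spec.rank_lt

theorem slotPath_of_isSlot {x : Fin n → ℝ} (hx : Generic m x) {i j : Fin n} {s : ℕ}
    (h : IsSlot m x i j s) : slotPath m x i = slotPath m x j ++ [s] := by
  have hex : ∃ k u, IsSlot m x i k u := ⟨j, s, h⟩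
  rw [slotPath, dif_pos hex]
  obtain ⟨h1, h2⟩ := h.parent_unique hx hex.choose_spec.choose_spec
  rw [← h2, ← h1]

theorem slotPath_eq_nil {x : Fin n → ℝ} {i : Fin n} (h : ¬ ∃ k u, IsSlot m x i k u) :
    slotPath m x i = [] := by
  rw [slotPath, dif_neg h]

theorem exists_isSlot_of_slotPath_ne_nil {x : Fin n → ℝ} (hx : Generic m x) {i : Fin n}
    (h : slotPath m x i ≠ []) :
    ∃ j s, IsSlot m x i j s ∧ slotPath m x i = slotPath m x j ++ [s] := by
  by_contra hcon
  refine h (slotPath_eq_nil ?_)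
  rintro ⟨j, s, hs⟩
  exact hcon ⟨j, s, hs, slotPath_of_isSlot hx hs⟩

theorem lt_add_of_slotPath_eq_nil {x : Fin n → ℝ} (hx : Generic m x) {i j : Fin n}
    (hij : i ≠ j) (h : slotPath m x i = []) {s : ℕ} (hs : s ≤ m) : x i < x j + s := by
  refine lt_of_le_of_ne (not_lt.1 fun hlt => ?_) (hx i j hij s hs)
  obtain ⟨k, u, hk⟩ := IsSlot.exists_of_lt hs hlt
  rw [slotPath_of_isSlot hx hk] at h
  simp at h

theorem slotPath_injective {x : Fin n → ℝ} (hx : Generic m x) :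
    Function.Injective (slotPath m x) := by
  have key : ∀ l : ℕ, ∀ i j, (slotPath m x i).length = l →
      slotPath m x i = slotPath m x j → i = j := by
    intro l
    induction l with
    | zero =>
      intro i j hi hij
      rw [List.length_eq_zero_iff] at hi
      by_contra hne
      have h1 := lt_add_of_slotPath_eq_nil hx hne hi (Nat.zero_le _)
      have h2 := lt_add_of_slotPath_eq_nil hx (Ne.symm hne) (hij ▸ hi) (Nat.zero_le _)
      simp only [Nat.cast_zero, add_zero] at h1 h2
      exact lt_asymm h1 h2
    | succ l ih =>
      intro i j hi hij
      have hne : slotPath m x i ≠ [] := by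
        intro h0
        rw [h0] at hi
        simp at hi
      obtain ⟨i', s, hs, hi'⟩ := exists_isSlot_of_slotPath_ne_nil hx hne
      obtain ⟨j', t, ht, hj'⟩ := exists_isSlot_of_slotPath_ne_nil hx (hij ▸ hne)
      have heq : slotPath m x i' ++ [s] = slotPath m x j' ++ [t] := by rw [← hi', ← hj', hij]
      obtain ⟨h1, h2⟩ := List.append_inj' heq rfl
      have h3 : s = t := by simpa using h2
      have h4 : i' = j' := ih i' j' (by rw [hi'] at hi; simpa using hi) h1
      subst h3 h4
      exact hs.child_unique hx ht
  exact fun i j h => key _ i j rfl h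

theorem slotPath_entry_le {x : Fin n → ℝ} (hx : Generic m x) (i : Fin n) :
    ∀ s ∈ slotPath m x i, s ≤ m := by
  have key : ∀ l : ℕ, ∀ i, (slotPath m x i).length = l → ∀ s ∈ slotPath m x i, s ≤ m := by
    intro l
    induction l with
    | zero =>
      intro i hi s hs
      rw [List.length_eq_zero_iff] at hi
      simp [hi] at hs
    | succ l ih =>
      intro i hi s hs
      obtain ⟨j, t, ht, hj⟩ := exists_isSlot_of_slotPath_ne_nil hx (List.ne_nil_of_mem hs)
      rw [hj] at hs hi
      rcases List.mem_append.1 hs with h | h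
      · exact ih j (by simpa using hi) s h
      · rw [List.mem_singleton.1 h]
        exact ht.le
  exact key _ i rfl

/-- The tree of a generic point. -/
noncomputable def treeOf (m : ℕ) (x : Fin n → ℝ) (hx : Generic m x) : Tree m n where
  path := slotPath m x
  entry_le := slotPath_entry_le hx
  inj := slotPath_injective hx
  parent_closed := by
    intro i hi
    obtain ⟨j, s, -, hj⟩ := exists_isSlot_of_slotPath_ne_nil hx hi
    exact ⟨j, by rw [hj]; simp⟩

theorem agrees_slotPath {x : Fin n → ℝ} (hx : Generic m x) {i j : Fin n} (hij : i ≠ j) :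
    Agrees m (slotPath m x) x i j := by
  have key : ∀ N : ℕ, ∀ i j, rank x i + rank x j = N → i ≠ j → Agrees m (slotPath m x) x i j := by
    intro N
    induction N using Nat.strong_induction_on with
    | _ N ih =>
      intro i j hN hij u hu
      have hinj : ∀ {a b}, a ≠ b → slotPath m x a ≠ slotPath m x b :=
        fun hab h => hab (slotPath_injective hx h)
      by_cases hnil : slotPath m x i = []
      · refine iff_of_true (lt_add_of_slotPath_eq_nil hx hij hnil hu) ?_
        have hj : slotPath m x j ≠ [] := hnil ▸ hinj hij.symm
        rw [hnil]
        cases hq : slotPath m x j with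
        | nil => exact absurd hq hj
        | cons b q =>
          rcases Nat.eq_zero_or_pos ((b :: q).sum + u) with h3 | h3
          · exact Or.inr ⟨by simpa using h3.symm, trivial⟩
          · exact Or.inl (by simpa using h3)
      · obtain ⟨k, s, hs, hk⟩ := exists_isSlot_of_slotPath_ne_nil hx hnil
        have hsum : (slotPath m x i).sum = (slotPath m x k).sum + s := by rw [hk]; simp
        rw [hs.lt_add_iff hx hij hu, below, hsum]
        have hr := hs.rank_lt
        rcases eq_or_ne k j with rfl | hkj
        · rw [hk]
          simp [not_lexlt_append_self]
        · have h1 := ih (rank x k + rank x j) (by omega) k j rfl hkj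
          have h2 := ih (rank x j + rank x k) (by omega) j k rfl hkj.symm
          rw [h1.add_lt_iff hx hkj (hinj hkj) h2 hs.le hu]
          refine or_congr_right (and_congr_right fun he => ?_)
          rw [hk, append_lexlt_iff (by rw [← hk]; exact hinj hij) (by omega)]
  exact key _ i j rfl hij

theorem compatible_treeOf {x : Fin n → ℝ} (hx : Generic m x) : Compatible (treeOf m x hx) x :=
  ⟨hx, fun _ _ hij => agrees_slotPath hx hij⟩

end Braid

namespace Braid

variable {m n : ℕ}

/-! ### Points with a given tree -/

/-- A base `m + 2` expansion whose digits are the complements of the entries of a word. -/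
noncomputable def wordVal (m : ℕ) : List ℕ → ℝ
  | [] => 0
  | a :: p => ((m : ℝ) + 1 - a + wordVal m p) / (m + 2)

theorem wordVal_mem_Ico {p : List ℕ} (hp : ∀ a ∈ p, a ≤ m) :
    0 ≤ wordVal m p ∧ wordVal m p < 1 := by
  induction p with
  | nil => simp [wordVal]
  | cons a p ih =>
    obtain ⟨h0, h1⟩ := ih fun b hb => hp b (List.mem_cons_of_mem _ hb)
    have ha : (a : ℝ) ≤ m := by exact_mod_cast hp a List.mem_cons_self
    have ha' : (0 : ℝ) ≤ a := a.cast_nonneg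
    have hm : (0 : ℝ) < m + 2 := by positivity
    rw [wordVal, div_lt_one hm]
    exact ⟨div_nonneg (by linarith) hm.le, by linarith⟩

theorem wordVal_cons_pos {a : ℕ} {p : List ℕ} (hp : ∀ b ∈ a :: p, b ≤ m) :
    0 < wordVal m (a :: p) := by
  obtain ⟨h0, -⟩ := wordVal_mem_Ico fun b hb => hp b (List.mem_cons_of_mem _ hb)
  have ha : (a : ℝ) ≤ m := by exact_mod_cast hp a List.mem_cons_self
  rw [wordVal]
  have hm : (0 : ℝ) < m + 2 := by positivity
  exact div_pos (by linarith) hm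

theorem wordVal_lt {p q : List ℕ} (hp : ∀ a ∈ p, a ≤ m) (hq : ∀ a ∈ q, a ≤ m)
    (h : lexlt p q) : wordVal m p < wordVal m q := by
  have hm : (0 : ℝ) < m + 2 := by positivity
  induction p generalizing q with
  | nil =>
    cases q with
    | nil => simp [lexlt] at h
    | cons b q => simpa [wordVal] using wordVal_cons_pos hq
  | cons a p ih =>
    cases q with
    | nil => simp [lexlt] at h
    | cons b q =>
      have hp' : ∀ c ∈ p, c ≤ m := fun c hc => hp c (List.mem_cons_of_mem _ hc)
      have hq' : ∀ c ∈ q, c ≤ m := fun c hc => hq c (List.mem_cons_of_mem _ hc)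
      rw [wordVal, wordVal, div_lt_div_iff_of_pos_right hm]
      rcases h with h | ⟨rfl, h⟩
      · have := (wordVal_mem_Ico hp').2
        have := (wordVal_mem_Ico hq').1
        have : (b : ℝ) + 1 ≤ a := by exact_mod_cast h
        linarith
      · have := ih hp' hq' h
        linarith

/-- The variant of `wordVal` in which the digit of the edge from the word `J` to its `s`-child
is replaced by `0`. -/
noncomputable def collapsedVal (m s : ℕ) : List ℕ → List ℕ → ℝ
  | _, [] => 0
  | [], a :: p => if a = s then wordVal m p / (m + 2) else wordVal m (a :: p)
  | b :: J, a :: p =>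
    if a = b then ((m : ℝ) + 1 - a + collapsedVal m s J p) / (m + 2) else wordVal m (a :: p)

theorem collapsedVal_mem_Ico {s : ℕ} {J p : List ℕ} (hp : ∀ a ∈ p, a ≤ m) :
    0 ≤ collapsedVal m s J p ∧ collapsedVal m s J p < 1 := by
  have hm : (0 : ℝ) < m + 2 := by positivity
  induction p generalizing J with
  | nil => cases J <;> simp [collapsedVal]
  | cons a p ih =>
    have hp' : ∀ b ∈ p, b ≤ m := fun b hb => hp b (List.mem_cons_of_mem _ hb)
    have ha : (a : ℝ) ≤ m := by exact_mod_cast hp a List.mem_cons_self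
    have ha' : (0 : ℝ) ≤ a := a.cast_nonneg
    cases J with
    | nil =>
      rw [collapsedVal]
      split_ifs
      · obtain ⟨h0, h1⟩ := wordVal_mem_Ico hp'
        rw [div_lt_one hm]
        exact ⟨div_nonneg h0 hm.le, by linarith⟩
      · exact wordVal_mem_Ico hp
    | cons b J =>
      rw [collapsedVal]
      split_ifs
      · obtain ⟨h0, h1⟩ := ih (J := J) hp'
        rw [div_lt_one hm]
        exact ⟨div_nonneg (by linarith) hm.le, by linarith⟩
      · exact wordVal_mem_Ico hp

theorem collapsedVal_append (m s : ℕ) (J : List ℕ) :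
    collapsedVal m s J (J ++ [s]) = collapsedVal m s J J := by
  induction J with
  | nil => simp [collapsedVal, wordVal]
  | cons b J ih => simp [collapsedVal, ih]

theorem collapsedVal_lt {s : ℕ} {J p q : List ℕ} (hp : ∀ a ∈ p, a ≤ m) (hq : ∀ a ∈ q, a ≤ m)
    (hJ : ∀ t, s < t → ¬ J ++ [t] <+: p) (hne : p = J → q ≠ J ++ [s]) (h : lexlt p q) :
    collapsedVal m s J p < collapsedVal m s J q := by
  have hm : (0 : ℝ) < m + 2 := by positivity
  induction J generalizing p q with
  | nil =>
    cases q with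
    | nil => cases p <;> simp [lexlt] at h
    | cons b q =>
      have hq' : ∀ c ∈ q, c ≤ m := fun c hc => hq c (List.mem_cons_of_mem _ hc)
      cases p with
      | nil =>
        rw [collapsedVal, collapsedVal]
        split_ifs with hb
        · subst hb
          cases q with
          | nil => simp at hne
          | cons c q => exact div_pos (wordVal_cons_pos hq') hm
        · exact wordVal_cons_pos hq
      | cons a p =>
        have hp' : ∀ c ∈ p, c ≤ m := fun c hc => hp c (List.mem_cons_of_mem _ hc)
        have has : a ≤ s := by
          by_contra has
          exact hJ a (by omega) (by simp)
        have hpI := wordVal_mem_Ico hp'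
        have hqI := wordVal_mem_Ico hq'
        rcases h with h | ⟨rfl, h⟩
        · have ha : (a : ℝ) ≤ m := by exact_mod_cast hp a List.mem_cons_self
          have hab : (b : ℝ) + 1 ≤ a := by exact_mod_cast h
          rw [collapsedVal, collapsedVal, if_neg (show b ≠ s by omega)]
          split_ifs
          · rw [wordVal, div_lt_div_iff_of_pos_right hm]
            linarith
          · rw [wordVal, wordVal, div_lt_div_iff_of_pos_right hm]
            linarith
        · have hpq := wordVal_lt hp' hq' h
          rw [collapsedVal, collapsedVal]
          split_ifs
          · exact div_lt_div_of_pos_right hpq hm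
          · exact wordVal_lt hp hq (Or.inr ⟨rfl, h⟩)
  | cons c J ih =>
    cases q with
    | nil => cases p <;> simp [lexlt] at h
    | cons b q =>
      have hq' : ∀ c ∈ q, c ≤ m := fun c hc => hq c (List.mem_cons_of_mem _ hc)
      have hb : (b : ℝ) ≤ m := by exact_mod_cast hq b List.mem_cons_self
      have hqI := wordVal_mem_Ico hq'
      have hqI' := collapsedVal_mem_Ico (s := s) (J := J) hq'
      cases p with
      | nil =>
        rw [collapsedVal, collapsedVal]
        split_ifs
        · exact div_pos (by linarith) hm
        · exact wordVal_cons_pos hq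
      | cons a p =>
        have hp' : ∀ c ∈ p, c ≤ m := fun c hc => hp c (List.mem_cons_of_mem _ hc)
        have hpI := wordVal_mem_Ico hp'
        have hpI' := collapsedVal_mem_Ico (s := s) (J := J) hp'
        rw [collapsedVal, collapsedVal, wordVal, wordVal]
        rcases h with h | ⟨rfl, h⟩
        · have hab : (b : ℝ) + 1 ≤ a := by exact_mod_cast h
          split_ifs <;> rw [div_lt_div_iff_of_pos_right hm] <;> linarith
        · have hpq := wordVal_lt hp' hq' h
          split_ifs with hac
          · subst hac
            have := ih hp' hq' (fun t ht hpre => hJ t ht (by simpa using hpre))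
              (by simpa using hne) h
            rw [div_lt_div_iff_of_pos_right hm]
            linarith
          · rw [div_lt_div_iff_of_pos_right hm]
            linarith

/-- The point whose coordinates are the drifts of the nodes, perturbed by `val`. -/
def driftPoint (T : Tree m n) (val : List ℕ → ℝ) (i : Fin n) : ℝ :=
  (T.path i).sum + val (T.path i)

theorem driftPoint_lt_of_lt (T : Tree m n) {val : List ℕ → ℝ}
    (hval : ∀ i, 0 ≤ val (T.path i) ∧ val (T.path i) < 1) {i j : Fin n} {s t : ℕ}
    (h : (T.path i).sum + s < (T.path j).sum + t) :
    driftPoint T val i + s < driftPoint T val j + t := by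
  have h1 : ((T.path i).sum : ℝ) + s + 1 ≤ (T.path j).sum + t := by exact_mod_cast h
  have := (hval i).2
  have := (hval j).1
  unfold driftPoint
  linarith

theorem driftPoint_lt_iff (T : Tree m n) (val : List ℕ → ℝ) {i j : Fin n} {s : ℕ}
    (h : (T.path i).sum = (T.path j).sum + s) :
    (driftPoint T val i < driftPoint T val j + s ↔ val (T.path i) < val (T.path j)) ∧
    (driftPoint T val j + s < driftPoint T val i ↔ val (T.path j) < val (T.path i)) := by
  have h1 : ((T.path i).sum : ℝ) = (T.path j).sum + s := by exact_mod_cast h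
  unfold driftPoint
  constructor <;> constructor <;> intro h <;> linarith

theorem below_or_of_ne {p q : List ℕ} (hne : p ≠ q) (s : ℕ) :
    (below p q s ∧ (p.sum < q.sum + s ∨ (p.sum = q.sum + s ∧ lexlt p q))) ∨
    (¬ below p q s ∧ (q.sum + s < p.sum ∨ (p.sum = q.sum + s ∧ lexlt q p))) := by
  by_cases h : below p q s
  · exact Or.inl ⟨h, h⟩
  · refine Or.inr ⟨h, ?_⟩
    rw [below] at h
    push Not at h
    rcases h.1.lt_or_eq with h1 | h1
    · exact Or.inl h1
    · refine Or.inr ⟨h1.symm, ?_⟩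
      rcases lexlt_trichotomy p q with h2 | h2 | h2
      · exact absurd h2 (h.2 h1.symm)
      · exact absurd h2 hne
      · exact h2

theorem exists_compatible (T : Tree m n) : ∃ x, Compatible T x := by
  have hval : ∀ i, 0 ≤ wordVal m (T.path i) ∧ wordVal m (T.path i) < 1 :=
    fun i => wordVal_mem_Ico (T.entry_le i)
  have key : ∀ i j, i ≠ j → ∀ s : ℕ,
      (below (T.path i) (T.path j) s ∧
        driftPoint T (wordVal m) i < driftPoint T (wordVal m) j + s) ∨
      (¬ below (T.path i) (T.path j) s ∧
        driftPoint T (wordVal m) j + s < driftPoint T (wordVal m) i) := by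
    intro i j hij s
    refine (below_or_of_ne (Compatible.path_ne T hij) s).imp (And.imp_right ?_)
      (And.imp_right ?_)
    · rintro (h | ⟨h, h'⟩)
      · simpa using driftPoint_lt_of_lt T hval (s := 0) (by simpa using h)
      · exact (driftPoint_lt_iff T _ h).1.2 (wordVal_lt (T.entry_le i) (T.entry_le j) h')
    · rintro (h | ⟨h, h'⟩)
      · simpa using driftPoint_lt_of_lt T hval (t := 0) (by simpa using h)
      · exact (driftPoint_lt_iff T _ h).2.2 (wordVal_lt (T.entry_le j) (T.entry_le i) h')
  refine ⟨driftPoint T (wordVal m), fun i j hij s _ => ?_, fun i j hij s _ => ?_⟩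
  · rcases key i j hij s with h | h
    · exact h.2.ne
    · exact h.2.ne'
  · rcases key i j hij s with h | h
    · exact iff_of_true h.2 h.1
    · exact iff_of_false (not_lt.2 h.2.le) h.1

theorem Tree.exists_path_eq_of_prefix (T : Tree m n) {w : List ℕ} {i : Fin n}
    (h : w <+: T.path i) : ∃ k, T.path k = w := by
  have key : ∀ l : ℕ, ∀ i, (T.path i).length = l → w <+: T.path i → ∃ k, T.path k = w := by
    intro l
    induction l with
    | zero =>
      intro i hi hw
      rw [List.length_eq_zero_iff] at hi
      rw [hi, List.prefix_nil] at hw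
      exact ⟨i, by rw [hi, hw]⟩
    | succ l ih =>
      intro i hi hw
      obtain ⟨j, s, hc⟩ := Compatible.exists_isChild_of_path_ne_nil T (i := i) (by
        intro h0
        rw [h0] at hi
        simp at hi)
      rw [Tree.IsChild, Tree.child] at hc
      rw [hc] at hw hi
      rcases List.prefix_concat_iff.1 hw with h | h
      · exact ⟨i, by rw [hc, h]⟩
      · exact ih j (by simpa using hi) h
  exact key _ i rfl h

/-- On the wall given by a cadet edge, all the other comparisons are strict and agree with those
of the tree. -/
theorem exists_wall_point {T : Tree m n} {i j : Fin n} {s : ℕ} (hc : T.IsCadet i j s) :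
    ∃ z : Fin n → ℝ, z i = z j + s ∧ ∀ a b u, a ≠ b → (a, b, u) ≠ (i, j, s) →
      (s = 0 → (a, b, u) ≠ (j, i, 0)) →
      (below (T.path a) (T.path b) u ∧ z a < z b + u) ∨
      (¬ below (T.path a) (T.path b) u ∧ z b + u < z a) := by
  have hi : T.path i = T.path j ++ [s] := hc.1
  have hsum : (T.path i).sum = (T.path j).sum + s := by rw [hi]; simp
  set val := collapsedVal m s (T.path j) with hvaldef
  have hval : ∀ a, 0 ≤ val (T.path a) ∧ val (T.path a) < 1 :=
    fun a => collapsedVal_mem_Ico (T.entry_le a)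
  have hlex : ∀ a b, lexlt (T.path a) (T.path b) → ¬ (a = j ∧ b = i) →
      val (T.path a) < val (T.path b) := by
    intro a b hab hne
    refine collapsedVal_lt (T.entry_le a) (T.entry_le b) (fun t ht hpre => ?_) ?_ hab
    · obtain ⟨k, hk⟩ := T.exists_path_eq_of_prefix hpre
      exact hc.2 t ht (T.entry_le k t (by rw [hk]; simp)) k hk
    · intro ha hb
      exact hne ⟨T.inj ha, T.inj (hb.trans hi.symm)⟩
  refine ⟨driftPoint T val, ?_, fun a b u hab hne hne0 => ?_⟩
  · have h1 : ((T.path i).sum : ℝ) = (T.path j).sum + s := by exact_mod_cast hsum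
    have h2 : val (T.path i) = val (T.path j) := by
      rw [hi, hvaldef, collapsedVal_append]
    unfold driftPoint
    linarith
  · refine (below_or_of_ne (Compatible.path_ne T hab) u).imp (And.imp_right ?_)
      (And.imp_right ?_)
    · rintro (h | ⟨h, h'⟩)
      · simpa using driftPoint_lt_of_lt T hval (s := 0) (by simpa using h)
      · refine (driftPoint_lt_iff T _ h).1.2 (hlex a b h' ?_)
        rintro ⟨rfl, rfl⟩
        have hs : s = 0 := by omega
        have hu : u = 0 := by omega
        exact hne0 hs (by rw [hu])
    · rintro (h | ⟨h, h'⟩)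
      · simpa using driftPoint_lt_of_lt T hval (t := 0) (by simpa using h)
      · refine (driftPoint_lt_iff T _ h).2.2 (hlex b a h' ?_)
        rintro ⟨rfl, rfl⟩
        have hu : u = s := by omega
        exact hne (by rw [hu])

end Braid

namespace Braid

variable {m n : ℕ} {A : Set (Set (Fin n → ℝ))}

/-! ### Separation from the base region -/

/-- The points `x` and `y` lie on the same side of each hyperplane of `A` off which `x` lies. -/
def SameSide (m : ℕ) (A : Set (Set (Fin n → ℝ))) (x y : Fin n → ℝ) : Prop :=
  ∀ (i j : Fin n) (s : ℕ), TrIdxA m n A i j s →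
    (x i < x j + s → y i < y j + s) ∧ (x j + s < x i → y j + s < y i)

theorem IsTransitive.not_mem_add (htrans : IsTransitive m n A) {i j k : Fin n} {s t : ℕ}
    (hik : i ≠ k) (hs : TrIdx m n i j s) (ht : TrIdx m n j k t)
    (h : hyp n i j (s : ℝ) ∉ A) (h' : hyp n j k (t : ℝ) ∉ A) :
    hyp n i k ((s + t : ℕ) : ℝ) ∉ A := by
  push_cast
  exact htrans i j k hs.2.1 ht.2.1 hik s t hs ht h h'

theorem Tree.exists_isCadet {T : Tree m n} {l k : Fin n} {u : ℕ} (h : T.IsChild l k u) :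
    ∃ p t, u ≤ t ∧ t ≤ m ∧ T.IsCadet p k t := by
  classical
  have hu : u ≤ m := T.entry_le l u (by rw [h, Tree.child]; simp)
  let P : ℕ → Prop := fun t => ∃ p, T.IsChild p k t
  obtain ⟨p, hp⟩ := Nat.findGreatest_spec (P := P) hu ⟨l, h⟩
  exact ⟨p, Nat.findGreatest P m, Nat.le_findGreatest hu ⟨l, h⟩, Nat.findGreatest_le m, hp,
    fun t ht htm q hq => Nat.findGreatest_is_greatest ht htm ⟨q, hq⟩⟩

/-- The situation of a pair `x`, `y` on the same sides of `A` and of a triple `(i, j, s)` of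
minimal gap among those whose hyperplane separates `x` from `y`. -/
structure IsMinSeparating (m : ℕ) (A : Set (Set (Fin n → ℝ))) (x y : Fin n → ℝ)
    (i j : Fin n) (s : ℕ) : Prop where
  sameSide : SameSide m A x y
  trIdx : TrIdx m n i j s
  lt : x j + s < x i
  le : y i ≤ y j + s
  minimal : ∀ a b u, TrIdx m n a b u → x b + u < x a → x a - x b - u < x i - x j - s →
    y b + u < y a

namespace IsMinSeparating

variable {x y : Fin n → ℝ} {i j : Fin n} {s : ℕ}

theorem not_mem (h : IsMinSeparating m A x y i j s) : hyp n i j (s : ℝ) ∉ A := fun hA =>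
  not_lt.2 h.le ((h.sameSide i j s ⟨h.trIdx, hA⟩).2 h.lt)

theorem slot_cases (h : IsMinSeparating m A x y i j s) {k : Fin n} {u : ℕ} (hu : u ≤ m)
    (h1 : x j + s < x k + u) (h2 : x k + u < x i) :
    (u = 0 ∧ i < k ∧ hyp n k i ((0 : ℕ) : ℝ) ∉ A) ∨
    (s ≤ u ∧ TrIdx m n j k (u - s) ∧ hyp n j k ((u - s : ℕ) : ℝ) ∉ A) := by
  obtain ⟨hsm, hij, hpos⟩ := h.trIdx
  have hle := h.le
  have hu0 : (0 : ℝ) ≤ u := u.cast_nonneg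
  have hki : k ≠ i := by
    rintro rfl
    linarith
  have hkj : k ≠ j := by
    rintro rfl
    have hsu : (s : ℝ) < u := by linarith
    have hsu' : s < u := by exact_mod_cast hsu
    have := h.minimal i k u ⟨hu, hij, Or.inl (by omega)⟩ h2 (by linarith)
    linarith
  by_cases hik : 0 < u ∨ k < i
  · have h3 := h.minimal i k u ⟨hu, hki.symm, hik⟩ h2 (by linarith)
    right
    by_cases hkj' : u < s ∨ (u = s ∧ j < k)
    · have hus : u ≤ s := by omega
      have h4 := h.minimal k j (s - u) ⟨by omega, hkj, by omega⟩
        (by push_cast [hus]; linarith) (by push_cast [hus]; linarith)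
      push_cast [hus] at h4
      linarith
    · have hus : s ≤ u := by omega
      have htr : TrIdx m n j k (u - s) := ⟨by omega, hkj.symm, by omega⟩
      refine ⟨hus, htr, fun hA => ?_⟩
      have h4 := (h.sameSide j k (u - s) ⟨htr, hA⟩).1 (by push_cast [hus]; linarith)
      push_cast [hus] at h4
      linarith
  · have hu' : u = 0 := by omega
    have hik' : i < k := by omega
    subst hu'
    refine Or.inl ⟨rfl, hik', fun hA => ?_⟩
    have h3 := h.minimal k j s ⟨hsm, hkj, by omega⟩ (by simpa using h1)
      (by simp only [Nat.cast_zero, add_zero] at h2; linarith)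
    have h4 := (h.sameSide k i 0 ⟨⟨Nat.zero_le _, hki, Or.inr hik'⟩, hA⟩).1 (by simpa using h2)
    simp only [Nat.cast_zero, add_zero] at h4
    linarith

theorem not_mem_of_sub (h : IsMinSeparating m A x y i j s) {p : Fin n} {d : ℕ} (hd : 0 < d)
    (hds : d + s ≤ m) (h1 : x j + s < x p - d) (h2 : x p - d < x i) :
    p ≠ j ∧ TrIdx m n p i d ∧ hyp n p i (d : ℝ) ∉ A := by
  have hle := h.le
  have hs0 : (0 : ℝ) ≤ s := s.cast_nonneg
  have hd0 : (0 : ℝ) < d := by exact_mod_cast hd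
  have hpj : p ≠ j := by
    rintro rfl
    linarith
  have h3 := h.minimal p j (d + s) ⟨hds, hpj, Or.inl (by omega)⟩
    (by push_cast; linarith) (by push_cast; linarith)
  push_cast at h3
  have hpi : p ≠ i := by
    rintro rfl
    linarith
  have htr : TrIdx m n p i d := ⟨by omega, hpi, Or.inl hd⟩
  refine ⟨hpj, htr, fun hA => ?_⟩
  have h4 := (h.sameSide p i d ⟨htr, hA⟩).1 (by linarith)
  linarith

theorem false_of_mem_Tset (h : IsMinSeparating m A x y i j s) (htrans : IsTransitive m n A)
    {T : Tree m n} (hT : T ∈ Tset m n A) (hc : Compatible T x) : False := by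
  classical
  have htr := h.trIdx
  obtain ⟨hsm, hij, hpos⟩ := h.trIdx
  have hs0 : (0 : ℝ) ≤ s := s.cast_nonneg
  let S : Finset (Fin n) := Finset.univ.filter fun l =>
    (l = i ∨ (i < l ∧ hyp n l i ((0 : ℕ) : ℝ) ∉ A)) ∧ x j + s < x l ∧ x l ≤ x i
  obtain ⟨l, hlS, hmin⟩ := S.exists_min_image x
    ⟨i, by simpa [S] using h.lt⟩
  simp only [S, Finset.mem_filter, Finset.mem_univ, true_and] at hlS hmin
  obtain ⟨hli, hjl, hlx⟩ := hlS
  have hlj : l ≠ j := by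
    rintro rfl
    linarith
  have hilab : i ≤ l := hli.elim (fun h => h.ge) fun h => h.1.le
  have htr_lj : TrIdx m n l j s := ⟨hsm, hlj, hpos.imp_right fun h => h.trans_le hilab⟩
  have hA_lj : hyp n l j (s : ℝ) ∉ A := by
    rcases hli with rfl | ⟨hli, hA⟩
    · exact h.not_mem
    · have := htrans.not_mem_add hlj ⟨Nat.zero_le _, hli.ne', Or.inr hli⟩ htr hA h.not_mem
      rwa [Nat.zero_add] at this
  obtain ⟨k, u, hlk⟩ := hc.exists_isChild_of_lt hsm hjl
  have hslot := hc.isSlot_of_isChild hlk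
  have hum := hslot.le
  have hkl := hslot.lt
  have hjk_le : x j + s ≤ x k + u := by
    by_contra hlt
    exact absurd (hslot.not_between j s hsm (not_le.1 hlt)) (not_le.2 hjl)
  have hu0 : (0 : ℝ) ≤ u := u.cast_nonneg
  have hjk : (k = j ∧ u = s) ∨
      (s ≤ u ∧ TrIdx m n j k (u - s) ∧ hyp n j k ((u - s : ℕ) : ℝ) ∉ A) := by
    rcases hjk_le.lt_or_eq with hlt | heq
    · rcases h.slot_cases hum hlt (hkl.trans_le hlx) with ⟨rfl, hik, hA⟩ | hA
      · simp only [Nat.cast_zero, add_zero] at hkl hlt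
        have := hmin k ⟨Or.inr ⟨hik, hA⟩, hlt, (hkl.trans_le hlx).le⟩
        linarith
      · exact Or.inr hA
    · left
      have hkj : k = j := by
        by_contra hkj
        exact hc.generic.add_ne (Ne.symm hkj) hsm hum heq
      subst hkj
      exact ⟨rfl, by exact_mod_cast (add_left_cancel heq).symm⟩
  have hsu : s ≤ u := hjk.elim (fun h => h.2.ge) fun h => h.1
  have hextend : ∀ (q : Fin n) (d : ℕ), q ≠ k → TrIdx m n q j (d + s) →
      hyp n q j ((d + s : ℕ) : ℝ) ∉ A → hyp n q k ((d + u : ℕ) : ℝ) ∉ A := by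
    intro q d hqk htr_q hA_q
    rcases hjk with ⟨rfl, rfl⟩ | ⟨-, htr', hA'⟩
    · exact hA_q
    · have := htrans.not_mem_add hqk htr_q htr' hA_q hA'
      rwa [show d + s + (u - s) = d + u by omega] at this
  have hlk_ne : l ≠ k := by
    rintro rfl
    linarith
  have hno : ∀ p t, TrIdx m n p k t → hyp n p k (t : ℝ) ∉ A → ¬ T.IsCadet p k t :=
    fun p t h1 h2 => hT p k t h1 fun h3 => h2 h3.2
  obtain ⟨p, t, hut, htm, hcad⟩ := Tree.exists_isCadet hlk
  have hpslot := hc.isSlot_of_isChild hcad.1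
  have hkp := hpslot.lt
  have hpk : p ≠ k := by
    rintro rfl
    have : (0 : ℝ) ≤ t := t.cast_nonneg
    linarith
  rcases hut.eq_or_lt with rfl | hut
  · obtain rfl : p = l := hpslot.child_unique hc.generic hslot
    have hA := hextend p 0 hpk (by rwa [Nat.zero_add]) (by rwa [Nat.zero_add])
    rw [Nat.zero_add] at hA
    refine hno p u ⟨hum, hpk, ?_⟩ hA hcad
    rcases hjk with ⟨rfl, rfl⟩ | ⟨-, htr', -⟩
    · exact htr_lj.2.2
    · have h1 := htr'.2.2
      have h2 := htr_lj.2.2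
      omega
  · have hpl : p ≠ l := by
      rintro rfl
      exact hut.ne (hslot.parent_unique hc.generic hpslot).2
    have hlt : x p < x l + ((t - u : ℕ) : ℝ) :=
      (hpslot.lt_add_iff hc.generic hpl (by omega)).2 (by push_cast [hut.le]; linarith)
    have hcast : ((t - u : ℕ) : ℝ) = t - u := by push_cast [hut.le]; rfl
    obtain ⟨hpj, htr_pi, hA_pi⟩ := h.not_mem_of_sub (p := p) (d := t - u) (by omega) (by omega)
      (by rw [hcast]; linarith) (by linarith)
    have hA_pj := htrans.not_mem_add hpj htr_pi htr hA_pi h.not_mem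
    have hA_pk := hextend p (t - u) hpk ⟨by omega, hpj, Or.inl (by omega)⟩ hA_pj
    rw [Nat.sub_add_cancel hut.le] at hA_pk
    exact hno p t ⟨htm, hpk, Or.inl (by omega)⟩ hA_pk hcad

end IsMinSeparating

/-- A tree of `T_m^n(A)` gives the lowest Catalan region of its region of `A`. -/
theorem lt_of_sameSide (htrans : IsTransitive m n A) {T : Tree m n} (hT : T ∈ Tset m n A)
    {x y : Fin n → ℝ} (hc : Compatible T x) (hxy : SameSide m A x y) {i j : Fin n} {s : ℕ}
    (htr : TrIdx m n i j s) (hlt : x j + s < x i) : y j + s < y i := by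
  classical
  by_contra hcon
  let S : Finset (Fin n × Fin n × Fin (m + 1)) := Finset.univ.filter fun a =>
    TrIdx m n a.1 a.2.1 a.2.2 ∧ x a.2.1 + ((a.2.2 : ℕ) : ℝ) < x a.1 ∧
      y a.1 ≤ y a.2.1 + ((a.2.2 : ℕ) : ℝ)
  obtain ⟨⟨a, b, u⟩, haS, hmin⟩ := S.exists_min_image
    (fun a => x a.1 - x a.2.1 - ((a.2.2 : ℕ) : ℝ))
    ⟨(i, j, ⟨s, Nat.lt_succ_of_le htr.1⟩), by
      simp only [S, Finset.mem_filter, Finset.mem_univ, true_and]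
      exact ⟨htr, hlt, not_lt.1 hcon⟩⟩
  simp only [S, Finset.mem_filter, Finset.mem_univ, true_and] at haS hmin
  refine IsMinSeparating.false_of_mem_Tset (i := a) (j := b) (s := u)
    ⟨hxy, haS.1, haS.2.1, haS.2.2, fun a' b' u' htr' hlt' hgap => ?_⟩ htrans hT hc
  by_contra hcon'
  have := hmin (a', b', ⟨u', Nat.lt_succ_of_le htr'.1⟩) ⟨htr', hlt', not_lt.1 hcon'⟩
  exact absurd hgap (not_lt.2 this)

end Braid

namespace Braid

variable {m n : ℕ} {A : Set (Set (Fin n → ℝ))}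

/-! ### Regions as sign classes -/

theorem mem_hyp {i j : Fin n} {s : ℝ} {x : Fin n → ℝ} : x ∈ hyp n i j s ↔ x i = x j + s :=
  sub_eq_iff_eq_add'

theorem mem_sUnion_iff (hA : A ⊆ catArr m n) {x : Fin n → ℝ} :
    x ∈ ⋃₀ A ↔ ∃ (i j : Fin n) (s : ℕ), TrIdxA m n A i j s ∧ x i = x j + s := by
  constructor
  · rintro ⟨H, hH, hx⟩
    obtain ⟨i, j, s, hij, hs1, hs2, rfl⟩ := hA hH
    rcases lt_or_ge 0 s with hs | hs
    · lift s to ℕ using hs.le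
      refine ⟨i, j, s, ⟨⟨by omega, hij.ne, Or.inl (by omega)⟩, by simpa using hH⟩, ?_⟩
      simpa using mem_hyp.1 hx
    · obtain ⟨t, ht⟩ := Int.eq_ofNat_of_zero_le (neg_nonneg.2 hs)
      obtain rfl : s = -(t : ℤ) := by omega
      have heq : hyp n i j ((-(t : ℤ) : ℤ) : ℝ) = hyp n j i (t : ℝ) := by
        ext y
        rw [mem_hyp, mem_hyp]
        push_cast
        constructor <;> intro h <;> linarith
      rw [heq] at hH hx
      exact ⟨j, i, t, ⟨⟨by omega, hij.ne', Or.inr hij⟩, hH⟩, mem_hyp.1 hx⟩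
  · rintro ⟨i, j, s, h, hx⟩
    exact ⟨_, h.2, mem_hyp.2 hx⟩

theorem SameSide.refl (m : ℕ) (A : Set (Set (Fin n → ℝ))) (x : Fin n → ℝ) :
    SameSide m A x x := fun _ _ _ _ => ⟨id, id⟩

theorem SameSide.trans {x y z : Fin n → ℝ} (h : SameSide m A x y) (h' : SameSide m A y z) :
    SameSide m A x z := fun i j s hs =>
  ⟨(h' i j s hs).1 ∘ (h i j s hs).1, (h' i j s hs).2 ∘ (h i j s hs).2⟩

theorem convex_setOf_sameSide (m : ℕ) (A : Set (Set (Fin n → ℝ))) (x : Fin n → ℝ) :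
    Convex ℝ {y | SameSide m A x y} := by
  intro y hy z hz a b ha hb hab i j s hs
  obtain ⟨hy1, hy2⟩ := hy i j s hs
  obtain ⟨hz1, hz2⟩ := hz i j s hs
  simp only [Pi.add_apply, Pi.smul_apply, smul_eq_mul]
  have hab' : (s : ℝ) = a * s + b * s := by rw [← add_mul, hab, one_mul]
  constructor
  · intro h
    have h1 := hy1 h
    have h2 := hz1 h
    rcases ha.eq_or_lt with rfl | ha
    · obtain rfl : b = 1 := by linarith
      simpa using h2
    · have h3 := mul_lt_mul_of_pos_left h1 ha
      have h4 := mul_le_mul_of_nonneg_left h2.le hb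
      linarith
  · intro h
    have h1 := hy2 h
    have h2 := hz2 h
    rcases ha.eq_or_lt with rfl | ha
    · obtain rfl : b = 1 := by linarith
      simpa using h2
    · have h3 := mul_lt_mul_of_pos_left h1 ha
      have h4 := mul_le_mul_of_nonneg_left h2.le hb
      linarith

theorem connectedComponentIn_eq_setOf_sameSide (hA : A ⊆ catArr m n) {x : Fin n → ℝ}
    (hx : x ∈ (⋃₀ A)ᶜ) : connectedComponentIn (⋃₀ A)ᶜ x = {y | SameSide m A x y} := by
  apply Set.Subset.antisymm
  · intro y hy i j s hs
    have hpre : IsPreconnected (connectedComponentIn (⋃₀ A)ᶜ x) :=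
      isPreconnected_connectedComponentIn
    have hxm := mem_connectedComponentIn hx
    have hcont : ContinuousOn (fun z : Fin n → ℝ => z i - z j)
        (connectedComponentIn (⋃₀ A)ᶜ x) := by fun_prop
    have hno : ∀ z ∈ connectedComponentIn (⋃₀ A)ᶜ x, z i - z j ≠ s := fun z hz h =>
      connectedComponentIn_subset _ _ hz
        ((mem_sUnion_iff hA).2 ⟨i, j, s, hs, by linarith⟩)
    constructor
    · intro hlt
      by_contra hcon
      obtain ⟨z, hz, hz'⟩ := hpre.intermediate_value hxm hy hcont
        (show (s : ℝ) ∈ Set.Icc _ _ from ⟨by linarith, by linarith⟩)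
      exact hno z hz hz'
    · intro hlt
      by_contra hcon
      obtain ⟨z, hz, hz'⟩ := hpre.intermediate_value hy hxm hcont
        (show (s : ℝ) ∈ Set.Icc _ _ from ⟨by linarith, by linarith⟩)
      exact hno z hz hz'
  · refine (convex_setOf_sameSide m A x).isPreconnected.subset_connectedComponentIn
      (SameSide.refl m A x) fun y hy hyA => ?_
    obtain ⟨i, j, s, hs, heq⟩ := (mem_sUnion_iff hA).1 hyA
    obtain ⟨h1, h2⟩ := hy i j s hs
    rcases lt_trichotomy (x i) (x j + s) with h | h | h
    · exact (h1 h).ne heq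
    · exact hx ((mem_sUnion_iff hA).2 ⟨i, j, s, hs, h⟩)
    · exact (h2 h).ne' heq

theorem Generic.mem_compl_sUnion (hA : A ⊆ catArr m n) {x : Fin n → ℝ} (hx : Generic m x) :
    x ∈ (⋃₀ A)ᶜ := by
  intro h
  obtain ⟨i, j, s, hs, heq⟩ := (mem_sUnion_iff hA).1 h
  exact hx i j hs.1.2.1 s hs.1.1 heq

theorem Phi_eq_setOf_sameSide {T : Tree m n} {x : Fin n → ℝ} (hc : Compatible T x) :
    Phi m n A T = {y | SameSide m A x y} := by
  ext y
  refine forall_congr' fun i => forall_congr' fun j => forall_congr' fun s =>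
    forall_congr' fun hs => ?_
  have hij := hs.1.2.1
  have hagree := hc.agrees i j hij s hs.1.1
  have hne := hc.generic i j hij s hs.1.1
  have h1 : x j + s < x i ↔ ¬ x i < x j + s :=
    ⟨fun h => not_lt.2 h.le, fun h => lt_of_le_of_ne (not_lt.1 h) hne.symm⟩
  rw [Tree.child, vlt_append_iff (Compatible.path_ne T hij),
    vle_append_iff (Compatible.path_ne T hij), sub_lt_iff_lt_add', lt_sub_iff_add_lt', h1, hagree]

/-! ### Perturbation and wall crossing -/

theorem Generic.of_trIdx {x : Fin n → ℝ}
    (h : ∀ i j s, TrIdx m n i j s → x i ≠ x j + s) : Generic m x := by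
  intro i j hij s hs
  by_cases htr : 0 < s ∨ j < i
  · exact h i j s ⟨hs, hij, htr⟩
  · obtain rfl : s = 0 := by omega
    have := h j i 0 ⟨Nat.zero_le _, hij.symm, Or.inr (by omega)⟩
    simp only [Nat.cast_zero, add_zero] at this ⊢
    exact this.symm

theorem eventually_forall_trIdx {P : Fin n → Fin n → ℕ → ℝ → Prop} {l : Filter ℝ}
    (h : ∀ i j s, TrIdx m n i j s → ∀ᶠ ε in l, P i j s ε) :
    ∀ᶠ ε in l, ∀ i j s, TrIdx m n i j s → P i j s ε := by
  have : ∀ᶠ ε in l, ∀ (i j : Fin n) (s : Fin (m + 1)), TrIdx m n i j s → P i j s ε := by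
    simp only [Filter.eventually_all]
    intro i j s hs
    exact h i j s hs
  filter_upwards [this] with ε hε i j s hs
  exact hε i j ⟨s, Nat.lt_succ_of_le hs.1⟩ hs

open Filter Topology in
theorem exists_generic_sameSide (m : ℕ) (A : Set (Set (Fin n → ℝ))) (z : Fin n → ℝ) :
    ∃ x, Generic m x ∧ SameSide m A z x := by
  let w : ℝ → Fin n → ℝ := fun ε k => z k + ε * (k : ℕ)
  have hw : ∀ k, Continuous fun ε => w ε k := fun k => by fun_prop
  have hw0 : ∀ k, w 0 k = z k := fun k => by simp [w]
  have hev : ∀ᶠ ε in 𝓝[>] (0 : ℝ), ∀ i j s, TrIdx m n i j s →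
      w ε i ≠ w ε j + s ∧ (z i < z j + s → w ε i < w ε j + s) ∧
        (z j + s < z i → w ε j + s < w ε i) := by
    apply eventually_forall_trIdx
    intro i j s hs
    rcases lt_trichotomy (z i) (z j + s) with h | h | h
    · have h1 : ∀ᶠ ε in 𝓝 (0 : ℝ), w ε i < w ε j + s :=
        (hw i).continuousAt.eventually_lt ((hw j).add continuous_const).continuousAt
          (by simpa only [hw0] using h)
      filter_upwards [nhdsWithin_le_nhds h1] with ε hε
      exact ⟨hε.ne, fun _ => hε, fun h' => absurd h' h.asymm⟩
    · filter_upwards [self_mem_nhdsWithin] with ε hε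
      refine ⟨fun heq => ?_, fun h' => absurd h h'.ne, fun h' => absurd h h'.ne'⟩
      have h1 : ε * ((i : ℕ) - (j : ℕ) : ℝ) = 0 := by
        simp only [w] at heq
        linarith
      rcases mul_eq_zero.1 h1 with h2 | h2
      · exact (ne_of_gt hε) h2
      · exact hs.2.1 (Fin.ext (by exact_mod_cast sub_eq_zero.1 h2))
    · have h1 : ∀ᶠ ε in 𝓝 (0 : ℝ), w ε j + s < w ε i :=
        ((hw j).add continuous_const).continuousAt.eventually_lt (hw i).continuousAt
          (by simpa only [hw0, Pi.add_apply] using h)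
      filter_upwards [nhdsWithin_le_nhds h1] with ε hε
      exact ⟨hε.ne', fun h' => absurd h' h.asymm, fun _ => hε⟩
  obtain ⟨ε, hε⟩ := hev.exists
  exact ⟨w ε, Generic.of_trIdx fun i j s hs => (hε i j s hs).1,
    fun i j s hs => (hε i j s hs.1).2⟩

open Filter Topology in
/-- Crossing the wall of a cadet edge. -/
theorem exists_wall_crossing {T : Tree m n} {x : Fin n → ℝ} (hc : Compatible T x) {i j : Fin n}
    {s : ℕ} (htr : TrIdx m n i j s) (hcad : T.IsCadet i j s) :
    ∃ y, Generic m y ∧ y i < y j + s ∧ ∀ a b u, TrIdx m n a b u → (a, b, u) ≠ (i, j, s) →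
      (x a < x b + u ↔ y a < y b + u) := by
  obtain ⟨z, hz, hz'⟩ := exists_wall_point hcad
  let w : ℝ → Fin n → ℝ := fun ε k => z k - if k = i then ε else 0
  have hw : ∀ k, Continuous fun ε => w ε k := fun k => by
    by_cases hk : k = i <;> simp only [w, hk, if_true, if_false] <;> fun_prop
  have hw0 : ∀ k, w 0 k = z k := fun k => by simp [w]
  have hev : ∀ᶠ ε in 𝓝[>] (0 : ℝ), ∀ a b u, TrIdx m n a b u → (a, b, u) ≠ (i, j, s) →
      w ε a ≠ w ε b + u ∧ (x a < x b + u ↔ w ε a < w ε b + u) := by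
    apply eventually_forall_trIdx
    intro a b u hu
    by_cases hne : (a, b, u) = (i, j, s)
    · exact Eventually.of_forall fun _ h => absurd hne h
    have hagree := hc.agrees a b hu.2.1 u hu.1
    rcases hz' a b u hu.2.1 hne (by
      rintro rfl heq
      simp only [Prod.mk.injEq] at heq
      obtain ⟨rfl, rfl, rfl⟩ := heq
      have h1 := hu.2.2
      have h2 := htr.2.2
      omega) with ⟨hb, h⟩ | ⟨hb, h⟩
    · have h1 : ∀ᶠ ε in 𝓝 (0 : ℝ), w ε a < w ε b + u :=
        (hw a).continuousAt.eventually_lt ((hw b).add continuous_const).continuousAt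
          (by simpa only [hw0] using h)
      filter_upwards [nhdsWithin_le_nhds h1] with ε hε _
      exact ⟨hε.ne, iff_of_true (hagree.2 hb) hε⟩
    · have h1 : ∀ᶠ ε in 𝓝 (0 : ℝ), w ε b + u < w ε a :=
        ((hw b).add continuous_const).continuousAt.eventually_lt (hw a).continuousAt
          (by simpa only [hw0, Pi.add_apply] using h)
      filter_upwards [nhdsWithin_le_nhds h1] with ε hε _
      exact ⟨hε.ne', iff_of_false (fun h => hb (hagree.1 h)) hε.asymm⟩
  obtain ⟨ε, hε, hpos⟩ := (hev.and self_mem_nhdsWithin).exists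
  have hpos' : (0 : ℝ) < ε := hpos
  have hlt : w ε i < w ε j + s := by
    simp only [w, if_true, if_neg htr.2.1.symm]
    linarith
  refine ⟨w ε, Generic.of_trIdx fun a b u hu => ?_, hlt, fun a b u hu hne => (hε a b u hu hne).2⟩
  by_cases hne : (a, b, u) = (i, j, s)
  · simp only [Prod.mk.injEq] at hne
    obtain ⟨rfl, rfl, rfl⟩ := hne
    exact hlt.ne
  · exact (hε a b u hu hne).1

open Classical in
/-- The hyperplanes of the Catalan arrangement that separate `x` from the base region. -/
noncomputable def sepSet (m : ℕ) (x : Fin n → ℝ) : Finset (Fin n × Fin n × Fin (m + 1)) :=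
  Finset.univ.filter fun a =>
    TrIdx m n a.1 a.2.1 a.2.2 ∧ ¬ x a.1 < x a.2.1 + ((a.2.2 : ℕ) : ℝ)

theorem exists_mem_Tset_compatible (A : Set (Set (Fin n → ℝ))) (z : Fin n → ℝ) :
    ∃ T ∈ Tset m n A, ∃ x, Compatible T x ∧ SameSide m A z x := by
  obtain ⟨x, ⟨hx, hzx⟩, hmin⟩ := WellFounded.has_min
    (measure fun x : Fin n → ℝ => (sepSet m x).card).wf {x | Generic m x ∧ SameSide m A z x}
    (exists_generic_sameSide m A z)
  have hc := compatible_treeOf hx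
  refine ⟨treeOf m x hx, fun i j s htr hnA hcad => ?_, x, hc, hzx⟩
  obtain ⟨y, hy, hlt, hiff⟩ := exists_wall_crossing hc htr hcad
  have hxlt : x j + s < x i := (hc.isSlot_of_isChild hcad.1).lt
  refine hmin y ⟨hy, hzx.trans fun a b u hu => ?_⟩ (Finset.card_lt_card ?_)
  · have hne : (a, b, u) ≠ (i, j, s) := by
      intro h
      simp only [Prod.mk.injEq] at h
      obtain ⟨rfl, rfl, rfl⟩ := h
      exact hnA hu
    have h := hiff a b u hu.1 hne
    refine ⟨h.1, fun h' => lt_of_le_of_ne (not_lt.1 fun h'' => ?_)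
      (hy a b hu.1.2.1 u hu.1.1).symm⟩
    exact lt_asymm h' (h.2 h'')
  · refine (Finset.ssubset_iff_of_subset ?_).2 ⟨(i, j, ⟨s, Nat.lt_succ_of_le htr.1⟩), ?_, ?_⟩
    · rintro ⟨a, b, u⟩ ha
      simp only [sepSet, Finset.mem_filter, Finset.mem_univ, true_and] at ha ⊢
      refine ⟨ha.1, fun h => ha.2 ((hiff a b u ha.1 ?_).1 h)⟩
      intro h
      simp only [Prod.mk.injEq] at h
      obtain ⟨rfl, rfl, rfl⟩ := h
      exact ha.2 hlt
    · simp only [sepSet, Finset.mem_filter, Finset.mem_univ, true_and]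
      exact ⟨htr, not_lt.2 hxlt.le⟩
    · simp only [sepSet, Finset.mem_filter, Finset.mem_univ, true_and]
      exact fun h => h.2 hlt

theorem Compatible.congr {T : Tree m n} {x y : Fin n → ℝ} (hc : Compatible T x)
    (hy : Generic m y) (h : ∀ i j s, TrIdx m n i j s → (x j + s < x i ↔ y j + s < y i)) :
    Compatible T y := by
  refine ⟨hy, fun i j hij s hs => ?_⟩
  rw [← hc.agrees i j hij s hs]
  by_cases htr : 0 < s ∨ j < i
  · have hx := hc.generic i j hij s hs
    have hy' := hy i j hij s hs
    have h' := h i j s ⟨hs, hij, htr⟩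
    rw [← not_le, ← not_le, hx.symm.le_iff_lt, hy'.symm.le_iff_lt, h']
  · obtain rfl : s = 0 := by omega
    have := h j i 0 ⟨Nat.zero_le _, hij.symm, Or.inr (by omega)⟩
    simp only [Nat.cast_zero, add_zero] at this ⊢
    exact this.symm

theorem Phi_injOn (htrans : IsTransitive m n A) : Set.InjOn (Phi m n A) (Tset m n A) := by
  intro T hT T' hT' heq
  obtain ⟨x, hx⟩ := exists_compatible T
  obtain ⟨y, hy⟩ := exists_compatible T'
  rw [Phi_eq_setOf_sameSide hx, Phi_eq_setOf_sameSide hy] at heq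
  have hxy : SameSide m A x y := heq.symm.subset (SameSide.refl m A y)
  have hyx : SameSide m A y x := heq.subset (SameSide.refl m A x)
  exact (hx.congr hy.generic fun i j s hs =>
    ⟨lt_of_sameSide htrans hT hx hxy hs, lt_of_sameSide htrans hT' hy hyx hs⟩).tree_unique hy

theorem Phi_mem_regions (hA : A ⊆ catArr m n) (T : Tree m n) :
    (Phi m n A T).Nonempty ∧ Phi m n A T ∈ regions n A := by
  obtain ⟨x, hx⟩ := exists_compatible T
  rw [Phi_eq_setOf_sameSide hx]
  have hxA := hx.generic.mem_compl_sUnion hA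
  exact ⟨⟨x, SameSide.refl m A x⟩, x, hxA, (connectedComponentIn_eq_setOf_sameSide hA hxA).symm⟩

theorem Phi_surjOn (hA : A ⊆ catArr m n) :
    Set.SurjOn (Phi m n A) (Tset m n A) (regions n A) := by
  rintro R ⟨z, hz, rfl⟩
  obtain ⟨T, hT, x, hx, hzx⟩ := exists_mem_Tset_compatible (m := m) A z
  refine ⟨T, hT, ?_⟩
  have hxA := hx.generic.mem_compl_sUnion hA
  rw [Phi_eq_setOf_sameSide hx, ← connectedComponentIn_eq_setOf_sameSide hA hxA]
  refine (connectedComponentIn_eq ?_).symm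
  rw [connectedComponentIn_eq_setOf_sameSide hA hz]
  exact hzx

end Braid

theorem regions_bijection (m n : ℕ) (A : Set (Set (Fin n → ℝ)))
    (hA : A ⊆ Braid.catArr m n) (htrans : Braid.IsTransitive m n A) :
    Set.BijOn (Braid.Phi m n A) (Braid.Tset m n A) (Braid.regions n A) ∧
    ∀ T ∈ Braid.Tset m n A,
      (Braid.Phi m n A T).Nonempty ∧ Braid.Phi m n A T ∈ Braid.regions n A :=
  ⟨⟨fun T _ => (Braid.Phi_mem_regions hA T).2, Braid.Phi_injOn htrans, Braid.Phi_surjOn hA⟩,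
    fun T _ => Braid.Phi_mem_regions hA T⟩
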